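/- Let G be a finite group with a nonabelian minimal normal subgroup N. Assume there is a complex irreducible character ψ of N that extends to T := Stab_G(ψ), and set a := ψ(1)·|G:T|. Then: (i) n_1(G) ≤ n_a(G)·|G:T|, and (ii) n_2(G) ≤ n_{2a}(G)·|G:T| + (1/2)·n_a(G)·|G:T|. Moreover, if G = T then n_2(G) ≤ n_{2a}(G). -/

import Mathlib

open Module CategoryTheory

noncomputable section

/-- `χ : G → ℂ` is the character of an irreducible complex representation of `G`
of degree `d`. -/
def IsIrrCharDeg (G : Type) [Group G] (χ : G → ℂ) (d : ℕ) : Prop :=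
  ∃ V : FDRep ℂ G, Simple V ∧ χ = FDRep.character V ∧ finrank ℂ V = d

/-- `χ : G → ℂ` is an irreducible complex character of `G`. -/
def IsIrrChar (G : Type) [Group G] (χ : G → ℂ) : Prop :=
  ∃ d, IsIrrCharDeg G χ d

/-- `n_d(G)`: the number of irreducible complex characters of `G` of degree `d`. -/
def nChars (G : Type) [Group G] (d : ℕ) : ℕ :=
  {χ : G → ℂ | IsIrrCharDeg G χ d}.ncard

/-- The stabilizer (inertia group) in `G` of a function `ψ : N → ℂ` (e.g. a character of the
normal subgroup `N`) under the conjugation action of `G`, i.e. those `g : G` with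
`ψ (g n g⁻¹) = ψ n` for all `n ∈ N`. -/
def charStab {G : Type} [Group G] (N : Subgroup G) [N.Normal] (ψ : ↥N → ℂ) : Subgroup G where
  carrier := {g : G | ∀ n : N, ψ (MulAut.conjNormal g n) = ψ n}
  one_mem' := by
    intro n
    simp
  mul_mem' := by
    intro a b ha hb n
    rw [map_mul, MulAut.mul_apply, ha, hb]
  inv_mem' := by
    intro a ha n
    have h := ha (MulAut.conjNormal a⁻¹ n)
    rw [map_inv]
    rw [map_inv, ← MulAut.mul_apply, mul_inv_cancel, MulAut.one_apply] at h
    exact h.symm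

/-- The character `ψ` of the subgroup `N` extends to the subgroup `T` (so `N ≤ T`), with
extension `χ`: the restriction of `χ` to `N` equals `ψ`. -/
def ExtendsToChar {G : Type} [Group G] (N T : Subgroup G) (ψ : ↥N → ℂ) (χ : ↥T → ℂ) : Prop :=
  ∃ hle : N ≤ T, ∀ n : ↥N, χ (Subgroup.inclusion hle n) = ψ n


/-- The bilinear form on functions on a finite group. -/
def ipc (H : Type) [Group H] [Finite H] (f h : H → ℂ) : ℂ :=
  letI := Fintype.ofFinite H
  (Nat.card H : ℂ)⁻¹ * ∑ g : H, f g * h g⁻¹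

/-- `f` is a character (not necessarily irreducible). -/
def IsChr (H : Type) [Group H] (f : H → ℂ) : Prop :=
  ∃ V : FDRep ℂ H, f = FDRep.character V

section basics

variable {H : Type} [Group H]

lemma IsChr.of_rep {V : Type} [AddCommGroup V] [Module ℂ V] [Module.Finite ℂ V]
    (ρ : Representation ℂ H V) : IsChr H ρ.character := ⟨FDRep.of ρ, rfl⟩

lemma IsIrrChar.isChr {f : H → ℂ} (h : IsIrrChar H f) : IsChr H f := by
  obtain ⟨d, V, _, h, _⟩ := h
  exact ⟨V, h⟩

lemma IsChr.comp {K : Type} [Group K] (φ : K →* H) {f : H → ℂ} (h : IsChr H f) :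
    IsChr K (f ∘ φ) := by
  obtain ⟨V, rfl⟩ := h
  exact IsChr.of_rep (V := V) (V.ρ.comp φ)

lemma IsChr.mul {f h : H → ℂ} (hf : IsChr H f) (hh : IsChr H h) : IsChr H (f * h) := by
  obtain ⟨V, rfl⟩ := hf
  obtain ⟨W, rfl⟩ := hh
  have := IsChr.of_rep (Representation.tprod (V := V) (W := W) V.ρ W.ρ)
  rw [Representation.char_tensor] at this
  exact this

lemma IsChr.dual {f : H → ℂ} (hf : IsChr H f) : IsChr H (fun g => f g⁻¹) := by
  obtain ⟨V, rfl⟩ := hf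
  refine ⟨FDRep.of (Representation.dual (V := V) V.ρ), ?_⟩
  ext g
  rw [FDRep.char_dual]

lemma IsChr.conj {f : H → ℂ} (hf : IsChr H f) (g h : H) : f (h * g * h⁻¹) = f g := by
  obtain ⟨V, rfl⟩ := hf
  exact FDRep.char_conj V g h

lemma irrCharDeg_iff {f : H → ℂ} {d : ℕ} : IsIrrCharDeg H f d ↔ IsIrrChar H f ∧ f 1 = d := by
  constructor
  · rintro ⟨V, hV, rfl, rfl⟩
    exact ⟨⟨_, V, hV, rfl, rfl⟩, FDRep.char_one V⟩
  · rintro ⟨⟨_, V, hV, rfl, rfl⟩, h⟩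
    refine ⟨V, hV, rfl, ?_⟩
    rw [FDRep.char_one] at h
    exact_mod_cast h

variable [Finite H]

lemma ipc_eq [Fintype H] (f h : H → ℂ) :
    ipc H f h = (Nat.card H : ℂ)⁻¹ * ∑ g : H, f g * h g⁻¹ := by
  unfold ipc
  congr!

lemma cardC_ne (K : Type) [Group K] [Finite K] : (Nat.card K : ℂ) ≠ 0 := by
  exact_mod_cast Nat.card_pos.ne'

lemma ipc_comm (f h : H → ℂ) : ipc H f h = ipc H h f := by
  have := Fintype.ofFinite H
  rw [ipc_eq, ipc_eq]
  congr 1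
  rw [← Equiv.sum_comp (Equiv.inv H)]
  simp [mul_comm]

lemma ipc_add (f f' h : H → ℂ) : ipc H (f + f') h = ipc H f h + ipc H f' h := by
  have := Fintype.ofFinite H
  simp only [ipc_eq, Pi.add_apply, add_mul, Finset.sum_add_distrib, mul_add]

lemma ipc_smul (c : ℂ) (f h : H → ℂ) : ipc H (c • f) h = c * ipc H f h := by
  have := Fintype.ofFinite H
  simp only [ipc_eq, Pi.smul_apply, smul_eq_mul, mul_assoc, ← Finset.mul_sum]
  ring

lemma ipc_zero (h : H → ℂ) : ipc H 0 h = 0 := by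
  have := Fintype.ofFinite H
  simp [ipc_eq]

lemma ipc_msum (s : Multiset (H → ℂ)) (h : H → ℂ) :
    ipc H s.sum h = (s.map (fun f => ipc H f h)).sum := by
  induction s using Multiset.induction with
  | empty => simp [ipc_zero]
  | cons a s ih => simp [ipc_add, ih]

lemma IsIrrChar.of_norm {f : H → ℂ} (hf : IsChr H f) (h : ipc H f f = 1) : IsIrrChar H f := by
  have := Fintype.ofFinite H
  obtain ⟨V, rfl⟩ := hf
  refine ⟨_, V, ?_, rfl, rfl⟩
  rw [FDRep.simple_iff_char_is_norm_one]
  rw [ipc_eq, inv_mul_eq_one₀ (cardC_ne H)] at h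
  exact h.symm

open Classical in
lemma ipc_irr {f h : H → ℂ} (hf : IsIrrChar H f) (hh : IsIrrChar H h) :
    ipc H f h = if f = h then 1 else 0 := by
  have := Fintype.ofFinite H
  obtain ⟨_, V, hV, rfl, _⟩ := hf
  obtain ⟨_, W, hW, rfl, _⟩ := hh
  have : Invertible (Nat.card H : ℂ) := invertibleOfNonzero (cardC_ne H)
  have key := FDRep.char_orthonormal V W
  rw [ipc_eq, key]
  by_cases hi : Nonempty (V ≅ W)
  · rw [if_pos hi, if_pos (FDRep.char_iso hi.some)]
  · rw [if_neg hi, if_neg]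
    intro he
    rw [if_neg hi, ← he] at key
    have k2 := FDRep.char_orthonormal V V
    rw [key, if_pos ⟨Iso.refl V⟩] at k2
    exact one_ne_zero k2.symm

lemma trace_compl {V : Type} [AddCommGroup V] [Module ℂ V] [Module.Finite ℂ V]
    (p q : Submodule ℂ V) (h : IsCompl p q) (f : V →ₗ[ℂ] V) (hp : ∀ v ∈ p, f v ∈ p)
    (hq : ∀ v ∈ q, f v ∈ q) :
    LinearMap.trace ℂ V f = LinearMap.trace ℂ p (f.restrict hp) +
      LinearMap.trace ℂ q (f.restrict hq) := by
  rw [← LinearMap.trace_prodMap', ← LinearMap.trace_conj' _ (p.prodEquivOfIsCompl q h)]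
  congr 1
  apply LinearMap.ext
  intro v
  obtain ⟨w, rfl⟩ := (p.prodEquivOfIsCompl q h).surjective v
  simp [LinearEquiv.conj_apply]

lemma rep_decomp (n : ℕ) : ∀ (V : Type) [AddCommGroup V] [Module ℂ V] [Module.Finite ℂ V]
    (ρ : Representation ℂ H V), finrank ℂ V = n →
    ∃ s : Multiset (H → ℂ), (∀ χ ∈ s, IsIrrChar H χ) ∧ ρ.character = s.sum := by
  induction n using Nat.strong_induction_on with
  | _ n ih =>
  intro V _ _ _ ρ hn
  have := Fintype.ofFinite H
  have hinv : Invertible (Nat.card H : ℂ) := invertibleOfNonzero (cardC_ne H)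
  have hnz : NeZero (Nat.card H : ℂ) := ⟨cardC_ne H⟩
  by_cases h0 : n = 0
  · refine ⟨0, by simp, ?_⟩
    subst h0
    have : Subsingleton V := Module.finrank_zero_iff.mp hn
    ext g
    have : ρ g = 0 := by ext v; exact Subsingleton.elim _ _
    simp [Representation.character, this]
  by_cases hirr : Representation.IsIrreducible ρ
  · refine ⟨{ρ.character}, ?_, by simp⟩
    intro χ hχ
    rw [Multiset.mem_singleton] at hχ
    subst hχ
    apply IsIrrChar.of_norm (IsChr.of_rep ρ)
    rw [ipc_eq, Representation.char_orthonormal ρ ρ, if_pos ⟨Representation.Equiv.refl ρ⟩]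
  · have hnt : Nontrivial V := Module.nontrivial_of_finrank_pos (R := ℂ) (by omega)
    have : ∃ p : Subrepresentation ρ, p.toSubmodule ≠ ⊥ ∧ p.toSubmodule ≠ ⊤ := by
      by_contra hcon
      push Not at hcon
      apply hirr
      refine @IsSimpleOrder.mk _ _ _ ⟨⊥, ⊤, ?_⟩ ?_
      · intro he
        have := congrArg Subrepresentation.toSubmodule he
        exact bot_ne_top this
      · intro p
        by_cases hp : p.toSubmodule = ⊥
        · exact Or.inl (Subrepresentation.toSubmodule_injective hp)
        · exact Or.inr (Subrepresentation.toSubmodule_injective (hcon p hp))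
    obtain ⟨p, hp1, hp2⟩ := this
    obtain ⟨q, hq⟩ := exists_isCompl p
    have hq' : IsCompl p.toSubmodule q.toSubmodule := by
      constructor
      · rw [disjoint_iff, ← Subrepresentation.toSubmodule_inf, hq.inf_eq_bot]; rfl
      · rw [codisjoint_iff, ← Subrepresentation.toSubmodule_sup, hq.sup_eq_top]; rfl
    have hd := Submodule.finrank_add_eq_of_isCompl hq'
    have hpp : 0 < finrank ℂ p.toSubmodule := by
      rw [Nat.pos_iff_ne_zero]
      intro h
      exact hp1 (Submodule.finrank_eq_zero.mp h)
    have hpl : finrank ℂ p.toSubmodule < finrank ℂ V := Submodule.finrank_lt hp2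
    obtain ⟨s, hs, hs'⟩ := ih _ (by omega) p.toSubmodule p.toRepresentation rfl
    obtain ⟨t, ht, ht'⟩ := ih _ (by omega) q.toSubmodule q.toRepresentation rfl
    refine ⟨s + t, ?_, ?_⟩
    · intro χ hχ
      rcases Multiset.mem_add.mp hχ with h | h
      · exact hs _ h
      · exact ht _ h
    · rw [Multiset.sum_add, ← hs', ← ht']
      ext g
      exact trace_compl _ _ hq' (ρ g) (p.apply_mem_toSubmodule g) (q.apply_mem_toSubmodule g)

lemma IsChr.decomp {f : H → ℂ} (hf : IsChr H f) :
    ∃ s : Multiset (H → ℂ), (∀ χ ∈ s, IsIrrChar H χ) ∧ f = s.sum := by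
  obtain ⟨V, rfl⟩ := hf
  exact rep_decomp _ V V.ρ rfl

lemma ipc_count [DecidableEq (H → ℂ)] {s : Multiset (H → ℂ)} (hs : ∀ χ ∈ s, IsIrrChar H χ) {h : H → ℂ}
    (hh : IsIrrChar H h) : ipc H s.sum h = s.count h := by
  induction s using Multiset.induction with
  | empty => simp [ipc_zero]
  | cons a s ih =>
    rw [Multiset.sum_cons, ipc_add, ih (fun χ h => hs χ (Multiset.mem_cons_of_mem h)),
      ipc_irr (hs a (Multiset.mem_cons_self a s)) hh, Multiset.count_cons]
    by_cases hc : a = h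
    · simp [hc, add_comm]
    · simp [hc, Ne.symm hc]

lemma irr_finite : {χ : H → ℂ | IsIrrChar H χ}.Finite := by
  classical
  have hli : LinearIndependent ℂ (fun χ : {χ : H → ℂ | IsIrrChar H χ} => (χ : H → ℂ)) := by
    rw [linearIndependent_iff']
    intro s g hg i hi
    have h1 : ipc H (∑ j ∈ s, g j • (j : H → ℂ)) i = ∑ j ∈ s, g j * ipc H j i := by
      clear hg hi
      induction s using Finset.induction with
      | empty => simp [ipc_zero]
      | insert a s ha ih => rw [Finset.sum_insert ha, Finset.sum_insert ha, ipc_add, ih, ipc_smul]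
    rw [hg, ipc_zero, Finset.sum_eq_single i] at h1
    · rw [ipc_irr i.2 i.2] at h1
      simpa using h1.symm
    · intro b _ hb
      rw [ipc_irr b.2 i.2, if_neg (fun h => hb (Subtype.ext h)), mul_zero]
    · intro h; exact absurd hi h
  exact hli.setFinite

lemma irrDeg_finite (d : ℕ) : {χ : H → ℂ | IsIrrCharDeg H χ d}.Finite :=
  irr_finite.subset (fun _ h => ⟨d, h⟩)

end basics

section induction

variable {G : Type} [Group G] [Finite G]

open Classical in
/-- The induced class function. -/
def indc (T : Subgroup G) (θ : T → ℂ) (g : G) : ℂ :=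
  letI := Fintype.ofFinite G
  (Nat.card T : ℂ)⁻¹ * ∑ x : G, if h : x * g * x⁻¹ ∈ T then θ ⟨x * g * x⁻¹, h⟩ else 0

open Classical in
lemma indc_eq [Fintype G] (T : Subgroup G) (θ : T → ℂ) (g : G) : indc T θ g =
    (Nat.card T : ℂ)⁻¹ * ∑ x : G, if h : x * g * x⁻¹ ∈ T then θ ⟨x * g * x⁻¹, h⟩ else 0 := by
  unfold indc
  congr!

lemma trace_pi {ι W : Type} [Fintype ι] [DecidableEq ι] [AddCommGroup W] [Module ℂ W]
    [Module.Finite ℂ W] (M : (ι → W) →ₗ[ℂ] (ι → W)) :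
    LinearMap.trace ℂ _ M = ∑ x, LinearMap.trace ℂ W
      (LinearMap.proj x ∘ₗ M ∘ₗ LinearMap.single ℂ (fun _ : ι => W) x) := by
  have h1 : M = ∑ x, M ∘ₗ (LinearMap.single ℂ (fun _ : ι => W) x ∘ₗ LinearMap.proj x) := by
    apply LinearMap.ext
    intro f
    rw [LinearMap.sum_apply]
    simp only [LinearMap.comp_apply, LinearMap.proj_apply, ← map_sum]
    congr 1
    exact (Finset.univ_sum_single f).symm
  conv_lhs => rw [h1]
  rw [map_sum]
  refine Finset.sum_congr rfl fun x _ => ?_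
  rw [← LinearMap.comp_assoc, LinearMap.trace_comp_comm']

/-- averaging operator -/
def avgOp [Fintype G] (T : Subgroup G) [Fintype T] {W : Type} [AddCommGroup W] [Module ℂ W]
    (ρ : Representation ℂ T W) (g : G) : (G → W) →ₗ[ℂ] (G → W) where
  toFun f := fun x => (Nat.card T : ℂ)⁻¹ • ∑ t : T, ρ t (f ((t : G)⁻¹ * x * g))
  map_add' f h := by ext x; simp [Finset.sum_add_distrib]
  map_smul' c f := by ext x; simp [← Finset.smul_sum, smul_comm c]

lemma isChr_indc (T : Subgroup G) {θ : T → ℂ} (hθ : IsChr T θ) : IsChr G (indc T θ) := by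
  classical
  have := Fintype.ofFinite G
  have := Fintype.ofFinite T
  obtain ⟨W, rfl⟩ := hθ
  have key : (Representation.coind T.subtype (B := W) W.ρ).character = indc T W.character := by
    ext g
    have hm : ∀ f, avgOp T (W := W) W.ρ g f ∈ Representation.coindV T.subtype (A := W) W.ρ := by
      intro f t x
      simp only [avgOp, LinearMap.coe_mk, AddHom.coe_mk, map_smul, map_sum, Subgroup.coe_subtype]
      congr 1
      rw [← Equiv.sum_comp (Equiv.mulLeft t)]
      refine Finset.sum_congr rfl fun s _ => ?_
      simp [mul_assoc]
    have h2 := LinearMap.trace_restrict_eq_of_forall_mem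
      (Representation.coindV T.subtype (A := W) W.ρ) (avgOp T (W := W) W.ρ g) hm
    have h3 : (avgOp T (W := W) W.ρ g).restrict (fun f _ => hm f) =
        Representation.coind T.subtype (B := W) W.ρ g := by
      apply LinearMap.ext
      rintro ⟨f, hf⟩
      apply Subtype.ext
      funext x
      have : ∀ t : T, W.ρ t (f ((t : G)⁻¹ * x * g)) = f (x * g) := by
        intro t
        rw [← hf t]
        simp [mul_assoc]
      simp only [avgOp, LinearMap.restrict_apply, LinearMap.coe_mk, AddHom.coe_mk, this]
      rw [Finset.sum_const, Finset.card_univ, ← Nat.card_eq_fintype_card,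
        ← Nat.cast_smul_eq_nsmul ℂ, smul_smul, inv_mul_cancel₀ (cardC_ne T), one_smul]
      rfl
    rw [h3] at h2
    rw [Representation.character, h2, trace_pi, indc_eq, Finset.mul_sum]
    refine Finset.sum_congr rfl fun x _ => ?_
    have h4 : LinearMap.proj x ∘ₗ avgOp T (W := W) W.ρ g ∘ₗ LinearMap.single ℂ (fun _ : G => (W : Type)) x
        = (Nat.card T : ℂ)⁻¹ • ∑ t : T, if (t : G) = x * g * x⁻¹ then W.ρ t else 0 := by
      apply LinearMap.ext
      intro w
      simp only [avgOp, LinearMap.comp_apply, LinearMap.coe_mk, AddHom.coe_mk,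
        LinearMap.proj_apply, LinearMap.smul_apply, LinearMap.sum_apply]
      congr 1
      refine Finset.sum_congr rfl fun t _ => ?_
      by_cases h : (t : G) = x * g * x⁻¹
      · rw [if_pos h]
        have : (t : G)⁻¹ * x * g = x := by rw [h]; group
        rw [this]
        simp
      · rw [if_neg h]
        have : (t : G)⁻¹ * x * g ≠ x := by
          intro h'
          apply h
          rw [mul_assoc, inv_mul_eq_iff_eq_mul] at h'
          rw [h']; group
        simp [Pi.single_eq_of_ne this]
    rw [h4, map_smul, map_sum, smul_eq_mul]
    congr 1
    split_ifs with h
    · rw [Finset.sum_eq_single ⟨_, h⟩]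
      · simp [FDRep.character]
      · intro b _ hb
        rw [if_neg, map_zero]
        intro hb'
        exact hb (Subtype.ext hb')
      · simp
    · refine Finset.sum_eq_zero fun t _ => ?_
      rw [if_neg, map_zero]
      intro ht
      exact h (ht ▸ t.2)
  rw [← key]
  exact IsChr.of_rep _

lemma indc_one (T : Subgroup G) (θ : T → ℂ) : indc T θ 1 = T.index * θ 1 := by
  classical
  have := Fintype.ofFinite G
  rw [indc_eq]
  have : ∀ x : G, (if h : x * 1 * x⁻¹ ∈ T then θ ⟨x * 1 * x⁻¹, h⟩ else 0) = θ 1 := by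
    intro x
    have hx : x * 1 * x⁻¹ = 1 := by group
    rw [dif_pos (by rw [hx]; exact T.one_mem)]
    congr 1
    exact Subtype.ext hx
  simp only [this]
  rw [Finset.sum_const, Finset.card_univ, ← Nat.card_eq_fintype_card, nsmul_eq_mul,
    ← T.index_mul_card, Nat.cast_mul]
  field_simp [cardC_ne T]

lemma frob (T : Subgroup G) (θ : T → ℂ) {f : G → ℂ} (hf : IsChr G f) :
    ipc G (indc T θ) f = ipc T θ (f ∘ T.subtype) := by
  classical
  have := Fintype.ofFinite G
  have := Fintype.ofFinite T
  rw [ipc_eq, ipc_eq]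
  have h1 : ∀ x : G, ∑ g : G, (if h : x * g * x⁻¹ ∈ T then θ ⟨x * g * x⁻¹, h⟩ else 0) * f g⁻¹ =
      ∑ t : T, θ t * f (t : G)⁻¹ := by
    intro x
    rw [← Equiv.sum_comp (MulAut.conj x⁻¹).toEquiv]
    have h2 : ∀ g : G, (if h : x * (MulAut.conj x⁻¹).toEquiv g * x⁻¹ ∈ T then
        θ ⟨x * (MulAut.conj x⁻¹).toEquiv g * x⁻¹, h⟩ else 0) *
        f ((MulAut.conj x⁻¹).toEquiv g)⁻¹ = (if h : g ∈ T then θ ⟨g, h⟩ * f g⁻¹ else 0) := by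
      intro g
      have e1 : (MulAut.conj x⁻¹).toEquiv g = x⁻¹ * g * x := by simp
      have e2 : x * (MulAut.conj x⁻¹).toEquiv g * x⁻¹ = g := by rw [e1]; group
      have e3 : f ((MulAut.conj x⁻¹).toEquiv g)⁻¹ = f g⁻¹ := by
        rw [e1, ← hf.conj g⁻¹ x⁻¹]
        congr 1
        group
      rw [e3]
      simp only [e2]
      split_ifs <;> simp
    rw [Finset.sum_congr rfl (fun g _ => h2 g)]
    rw [Finset.sum_dite]
    simp only [Finset.sum_const_zero, add_zero]
    refine Finset.sum_bij' (fun g _ => ⟨g.1, (Finset.mem_filter.mp g.2).2⟩)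
      (fun t _ => ⟨t.1, Finset.mem_filter.mpr ⟨Finset.mem_univ _, t.2⟩⟩) ?_ ?_ ?_ ?_ ?_ <;> simp
  have h3 : ∑ g : G, indc T θ g * f g⁻¹ = (Nat.card T : ℂ)⁻¹ * ∑ x : G, ∑ g : G,
      (if h : x * g * x⁻¹ ∈ T then θ ⟨x * g * x⁻¹, h⟩ else 0) * f g⁻¹ := by
    simp only [indc_eq, mul_assoc, Finset.sum_mul, ← Finset.mul_sum]
    rw [Finset.sum_comm]
  rw [h3]
  simp only [h1]
  rw [Finset.sum_const, Finset.card_univ, ← Nat.card_eq_fintype_card, nsmul_eq_mul]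
  have hG := cardC_ne G
  have h5 : ∀ a b : ℂ, (Nat.card G : ℂ)⁻¹ * (a * ((Nat.card G : ℂ) * b)) = a * b := by
    intro a b
    field_simp
  rw [h5]
  rfl

end induction

section degrees

variable {H : Type} [Group H] [Finite H]

/-- degree as a natural number -/
def dgc (f : H → ℂ) : ℕ := ⌊(f 1).re⌋₊

omit [Finite H] in
lemma dgc_of_nat {f : H → ℂ} {d : ℕ} (h : f 1 = d) : dgc f = d := by
  simp [dgc, h]

omit [Finite H] in
lemma IsChr.dgc {f : H → ℂ} (hf : IsChr H f) : f 1 = dgc f := by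
  obtain ⟨V, rfl⟩ := hf
  rw [dgc_of_nat (FDRep.char_one V), FDRep.char_one]

lemma IsIrrChar.ipc_self {f : H → ℂ} (hf : IsIrrChar H f) : ipc H f f = 1 := by
  classical
  rw [ipc_irr hf hf, if_pos rfl]

lemma IsIrrChar.dgc_pos {f : H → ℂ} (hf : IsIrrChar H f) : 0 < dgc f := by
  rw [Nat.pos_iff_ne_zero]
  intro h0
  have h1 := hf.isChr.dgc
  have h2 := hf.ipc_self
  obtain ⟨_, V, _, rfl, _⟩ := hf
  rw [h0, FDRep.char_one] at h1
  have h3 : finrank ℂ V = 0 := by exact_mod_cast h1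
  have : Subsingleton V := Module.finrank_zero_iff.mp h3
  have h4 : V.character = 0 := by
    ext g
    have : V.ρ g = 0 := by ext v; exact Subsingleton.elim _ _
    simp [FDRep.character, this]
  rw [h4, ipc_zero] at h2
  exact zero_ne_one h2

omit [Finite H] in
lemma msum_one {s : Multiset (H → ℂ)} (hs : ∀ χ ∈ s, IsIrrChar H χ) :
    s.sum 1 = ((s.map dgc).sum : ℕ) := by
  induction s using Multiset.induction with
  | empty => simp
  | cons a s ih =>
    rw [Multiset.sum_cons, Pi.add_apply, ih (fun χ h => hs χ (Multiset.mem_cons_of_mem h)),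
      (hs a (Multiset.mem_cons_self a s)).isChr.dgc]
    simp

lemma trivial_irr : IsIrrChar H (1 : H → ℂ) := by
  have := Fintype.ofFinite H
  apply IsIrrChar.of_norm
  · have : (1 : H → ℂ) = (Representation.trivial ℂ H ℂ).character := by
      ext g
      simp only [Representation.character]
      have : (Representation.trivial ℂ H ℂ) g = 1 := by ext; simp
      rw [this, LinearMap.trace_one]; simp
    rw [this]
    exact IsChr.of_rep _
  · rw [ipc_eq]
    have := cardC_ne H
    simp

lemma ipc_nat {f h : H → ℂ} (hf : IsChr H f) (hh : IsIrrChar H h) : ∃ c : ℕ, ipc H f h = c := by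
  classical
  obtain ⟨s, hs, rfl⟩ := hf.decomp
  exact ⟨_, ipc_count hs hh⟩

/-- inner product as a natural number -/
def cgc (f h : H → ℂ) : ℕ := ⌊(ipc H f h).re⌋₊

lemma IsChr.cgc {f h : H → ℂ} (hf : IsChr H f) (hh : IsIrrChar H h) :
    ipc H f h = cgc f h := by
  obtain ⟨c, hc⟩ := ipc_nat hf hh
  simp [_root_.cgc, hc]

lemma cgc_le {f : H → ℂ} (hf : IsChr H f) : cgc f 1 ≤ dgc f ∧
    (cgc f 1 = dgc f → ∀ k, f k = f 1) := by
  classical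
  obtain ⟨s, hs, rfl⟩ := hf.decomp
  have h1 : cgc s.sum 1 = s.count 1 := by
    have := hf.cgc (trivial_irr)
    rw [ipc_count hs trivial_irr] at this
    exact_mod_cast this.symm
  have h2 : dgc s.sum = (s.map dgc).sum := dgc_of_nat (msum_one hs)
  have h3 : s.count 1 ≤ Multiset.card s := Multiset.count_le_card _ _
  have h4 : Multiset.card s ≤ (s.map dgc).sum := by
    have : (s.map (fun _ => 1)).sum ≤ (s.map dgc).sum :=
      Multiset.sum_map_le_sum_map _ _ (fun χ h => (hs χ h).dgc_pos)
    simpa using this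
  rw [h1, h2]
  refine ⟨h3.trans h4, fun h5 k => ?_⟩
  have h6 : s.count 1 = Multiset.card s := by omega
  rw [Multiset.count_eq_card] at h6
  have h7 := Multiset.eq_replicate.mpr ⟨rfl, fun b hb => (h6 b hb).symm⟩
  rw [h7]
  simp

lemma ipc_const {f : H → ℂ} (h : ∀ k, f k = f 1) : ipc H f 1 = f 1 := by
  have := Fintype.ofFinite H
  rw [ipc_eq]
  have h2 := cardC_ne H
  simp only [h]
  simp only [Pi.one_apply, mul_one, Finset.sum_const, Finset.card_univ, nsmul_eq_mul,
    ← Nat.card_eq_fintype_card]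
  field_simp

variable {K : Type} [Group K] [Finite K]

lemma ipc_msum_comp {s : Multiset (H → ℂ)} (hs : ∀ χ ∈ s, IsIrrChar H χ) (φ : K →* H)
    {h : K → ℂ} (hh : IsIrrChar K h) :
    ipc K (s.sum ∘ φ) h = ((s.map (fun f => cgc (f ∘ φ) h)).sum : ℕ) := by
  induction s using Multiset.induction with
  | empty =>
    have : (0 : H → ℂ) ∘ φ = 0 := rfl
    simp [this, ipc_zero]
  | cons a s ih =>
    have : (a + s.sum) ∘ φ = a ∘ φ + s.sum ∘ φ := rfl
    rw [Multiset.sum_cons, this, ipc_add, ih (fun χ h => hs χ (Multiset.mem_cons_of_mem h)),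
      ((hs a (Multiset.mem_cons_self a s)).isChr.comp φ).cgc hh]
    simp

lemma const_of_mem {s : Multiset (H → ℂ)} (hs : ∀ χ ∈ s, IsIrrChar H χ) (φ : K →* H)
    (hη : ∀ k, s.sum (φ k) = s.sum 1) {γ : H → ℂ} (hγ : γ ∈ s) (k : K) : γ (φ k) = γ 1 := by
  have hle : ∀ χ ∈ s, cgc (χ ∘ φ) 1 ≤ dgc χ := by
    intro χ hχ
    have := (cgc_le ((hs χ hχ).isChr.comp φ)).1
    simpa [dgc] using this
  have h1 : ((s.map (fun f => cgc (f ∘ φ) 1)).sum : ℕ) = (s.map dgc).sum := by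
    have h2 := ipc_msum_comp hs φ (trivial_irr (H := K))
    rw [ipc_const (f := s.sum ∘ φ) (by intro k; simpa using hη k)] at h2
    have h3 := msum_one hs
    simp only [Function.comp_apply, map_one] at h2
    rw [h3] at h2
    exact_mod_cast h2.symm
  have h4 : cgc (γ ∘ φ) 1 = dgc γ := by
    by_contra hne
    have := Multiset.sum_lt_sum hle ⟨γ, hγ, lt_of_le_of_ne (hle γ hγ) hne⟩
    omega
  have := (cgc_le ((hs γ hγ).isChr.comp φ)).2 (by rw [h4]; simp [dgc]) k
  simpa using this

lemma gallagher {χ : H → ℂ} (hχ : IsIrrChar H χ) (φ : K →* H) (hφ : IsIrrChar K (χ ∘ φ))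
    {β β' : H → ℂ} (hβ : IsChr H β) (hβ' : IsChr H β') (hb : ∀ k, β (φ k) = β 1)
    (hb' : ∀ k, β' (φ k) = β' 1) : ipc H (χ * β) (χ * β') = ipc H β β' := by
  classical
  have := Fintype.ofFinite H
  have := Fintype.ofFinite K
  have hP : IsChr H (χ * fun g => χ g⁻¹) := hχ.isChr.mul hχ.isChr.dual
  have hQ : IsChr H ((fun g => β g⁻¹) * β') := hβ.dual.mul hβ'
  obtain ⟨s, hs, hsP⟩ := hP.decomp
  obtain ⟨r, hr, hrQ⟩ := hQ.decomp
  have e1 : ipc H (χ * β) (χ * β') = ipc H s.sum r.sum := by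
    rw [← hsP, ← hrQ, ipc_eq, ipc_eq]
    congr 1
    refine Finset.sum_congr rfl fun g _ => ?_
    simp only [Pi.mul_apply, inv_inv]
    ring
  have e2 : ipc H β β' = ipc H 1 r.sum := by
    rw [← hrQ, ipc_eq, ipc_eq]
    congr 1
    refine Finset.sum_congr rfl fun g _ => ?_
    simp only [Pi.mul_apply, Pi.one_apply, inv_inv]
    ring
  have c1 : s.count 1 = 1 := by
    have h := ipc_count hs (trivial_irr (H := H))
    have h' : ipc H s.sum 1 = ipc H χ χ := by
      rw [← hsP, ipc_eq, ipc_eq]; simp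
    rw [h', hχ.ipc_self] at h
    exact_mod_cast h.symm
  obtain ⟨s', hs'⟩ := Multiset.exists_cons_of_mem (a := (1 : H → ℂ)) (s := s)
    (by rw [← Multiset.count_pos]; omega)
  have c2 : (s.map (fun f => cgc (f ∘ φ) 1)).sum = 1 := by
    have h := ipc_msum_comp hs φ (trivial_irr (H := K))
    have h' : ipc K (s.sum ∘ φ) 1 = ipc K (χ ∘ φ) (χ ∘ φ) := by
      rw [← hsP, ipc_eq, ipc_eq]; simp
    rw [h', hφ.ipc_self] at h
    exact_mod_cast h.symm
  have c3 : cgc ((1 : H → ℂ) ∘ φ) 1 = 1 := by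
    have : (1 : H → ℂ) ∘ φ = 1 := rfl
    rw [this, cgc, trivial_irr.ipc_self]
    simp
  rw [hs', Multiset.map_cons, Multiset.sum_cons, c3] at c2
  have c4 : ∀ γ ∈ s', cgc (γ ∘ φ) 1 = 0 := by
    have h0 : (s'.map (fun f => cgc (f ∘ φ) 1)).sum = 0 := by omega
    rw [Multiset.sum_eq_zero_iff] at h0
    intro γ hγ
    exact h0 _ (Multiset.mem_map_of_mem _ hγ)
  have c5 : ∀ γ ∈ s', ipc H γ r.sum = 0 := by
    intro γ hγ
    have hγi : IsIrrChar H γ := hs γ (by rw [hs']; exact Multiset.mem_cons_of_mem hγ)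
    rw [ipc_comm, ipc_count hr hγi]
    by_contra hne
    have hmem : γ ∈ r := by
      rw [← Multiset.count_pos, Nat.pos_iff_ne_zero]
      exact_mod_cast hne
    have hc : ∀ k, (γ ∘ φ) k = (γ ∘ φ) 1 := by
      intro k
      have := const_of_mem hr φ (by
        intro k
        rw [← hrQ]
        simp only [Pi.mul_apply, ← map_inv, hb, hb']
        simp) hmem k
      simpa using this
    have h1 := ipc_const hc
    rw [(hγi.isChr.comp φ).cgc trivial_irr, c4 γ hγ] at h1
    simp only [Function.comp_apply, map_one, hγi.isChr.dgc] at h1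
    have := hγi.dgc_pos
    have h2 : dgc γ = 0 := by exact_mod_cast h1.symm
    omega
  rw [e1, e2, hs', Multiset.sum_cons, ipc_add, ipc_msum]
  have : (s'.map (fun f => ipc H f r.sum)).sum = 0 := by
    apply Multiset.sum_eq_zero
    intro x hx
    obtain ⟨γ, hγ, rfl⟩ := Multiset.mem_map.mp hx
    exact c5 γ hγ
  rw [this, add_zero]

lemma IsIrrChar.comp_equiv {f : H → ℂ} (hf : IsIrrChar H f) (e : K ≃* H) :
    IsIrrChar K (f ∘ e) := by
  have := Fintype.ofFinite H
  have := Fintype.ofFinite K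
  apply IsIrrChar.of_norm (hf.isChr.comp e.toMonoidHom)
  rw [← hf.ipc_self, ipc_eq, ipc_eq, Nat.card_congr e.toEquiv, ← Equiv.sum_comp e.toEquiv]
  simp

end degrees

section kernel

lemma exists_matrix {K : Type} [Group K] (V : FDRep ℂ K) {d : ℕ} (hd : finrank ℂ V = d) :
    ∃ M : K →* Matrix (Fin d) (Fin d) ℂ, ∀ g, V.character g = (M g).trace := by
  let b := Module.finBasisOfFinrankEq ℂ V hd
  refine ⟨(LinearMap.toMatrixAlgEquiv b).toAlgHom.toRingHom.toMonoidHom.comp V.ρ, fun g => ?_⟩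
  rw [FDRep.character, LinearMap.trace_eq_matrix_trace ℂ b]
  rfl

lemma perf_hom {K : Type} [Group K] (hK : commutator K = ⊤) (f : K →* ℂ) (k : K) : f k = 1 := by
  have h := Abelianization.commutator_subset_ker f.toHomUnits
  rw [hK] at h
  have : k ∈ f.toHomUnits.ker := h trivial
  rw [MonoidHom.mem_ker] at this
  have h2 := congrArg Units.val this
  simpa using h2

lemma perf_lin {K : Type} [Group K] (hK : commutator K = ⊤) {χ : K → ℂ}
    (hχ : IsIrrCharDeg K χ 1) : χ = 1 := by
  obtain ⟨V, _, rfl, hd⟩ := hχ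
  obtain ⟨M, hM⟩ := exists_matrix V hd
  ext g
  rw [hM]
  have := perf_hom hK ((Matrix.detMonoidHom).comp M) g
  simpa [Matrix.trace, Matrix.det_fin_one] using this

lemma perf_deg_one {K : Type} [Group K] [Finite K] (hK : commutator K = ⊤)
    {s : Multiset (K → ℂ)} (hs : ∀ χ ∈ s, IsIrrChar K χ) (h1 : ∀ χ ∈ s, dgc χ = 1) (k : K) :
    s.sum k = s.sum 1 := by
  have : ∀ χ ∈ s, χ = 1 := by
    intro χ hχ
    apply perf_lin hK
    rw [irrCharDeg_iff]
    exact ⟨hs χ hχ, by rw [(hs χ hχ).isChr.dgc, h1 χ hχ]⟩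
  have h7 := Multiset.eq_replicate.mpr ⟨rfl, this⟩
  rw [h7]
  simp

lemma mat2_sq (A : Matrix (Fin 2) (Fin 2) ℂ) (h : A.det = 1) :
    (A * A).trace = A.trace * A.trace - 2 := by
  rw [Matrix.det_fin_two] at h
  simp only [Matrix.trace_fin_two, Matrix.mul_apply, Fin.sum_univ_two]
  linear_combination (-2) * h

lemma mat2_inv (A B : Matrix (Fin 2) (Fin 2) ℂ) (h : A.det = 1) (hB : B * A = 1) :
    B.trace = A.trace := by
  have : B = A.adjugate := by
    calc B = B * (A * A.adjugate) := by rw [Matrix.mul_adjugate, h, one_smul, mul_one]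
      _ = A.adjugate := by rw [← mul_assoc, hB, one_mul]
  rw [this, Matrix.adjugate_fin_two, Matrix.trace_fin_two, Matrix.trace_fin_two]
  simp [add_comm]

lemma mat2_central (A : Matrix (Fin 2) (Fin 2) ℂ) (h : A.det = 1) (hA : A * A = 1)
    (B : Matrix (Fin 2) (Fin 2) ℂ) : A * B = B * A := by
  have h1 : A = A.adjugate := by
    calc A = A * (A * A.adjugate) := by rw [Matrix.mul_adjugate, h, one_smul, mul_one]
      _ = A.adjugate := by rw [← mul_assoc, hA, one_mul]
  rw [Matrix.adjugate_fin_two] at h1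
  have h00 := congrFun (congrFun h1 0) 0
  have h01 := congrFun (congrFun h1 0) 1
  have h10 := congrFun (congrFun h1 1) 0
  simp at h00 h01 h10
  have e01 : A 0 1 = 0 := by linear_combination (1/2) * h01
  have e10 : A 1 0 = 0 := by linear_combination (1/2) * h10
  ext i j
  fin_cases i <;> fin_cases j <;> simp [Matrix.mul_apply, Fin.sum_univ_two, e01, e10, h00] <;> ring

variable {G : Type} [Group G] [Finite G]

lemma const_on_N (N : Subgroup G) [N.Normal]
    (hmin : ∀ M : Subgroup G, M.Normal → M ≤ N → M ≠ ⊥ → M = N)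
    (hnab : ¬ ∀ x y : ↥N, x * y = y * x) {χ : G → ℂ} {d : ℕ} (hd : d = 1 ∨ d = 2)
    (hχ : IsIrrCharDeg G χ d) (n : N) : χ n = χ 1 := by
  classical
  have := Fintype.ofFinite N
  have hperf : commutator N = ⊤ := by
    have h1 : ⁅N, N⁆ = N := by
      apply hmin _ inferInstance (Subgroup.commutator_le_left N N)
      intro h
      rw [Subgroup.commutator_eq_bot_iff_le_centralizer] at h
      apply hnab
      intro x y
      apply Subtype.ext
      exact (Subgroup.mem_centralizer_iff.mp (h x.2) y y.2).symm
    apply Subgroup.map_injective N.subtype_injective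
    rw [Subgroup.map_subtype_commutator, h1, ← MonoidHom.range_eq_map, Subgroup.range_subtype]
  have hf : IsChr N (χ ∘ N.subtype) := IsChr.comp N.subtype (IsIrrChar.isChr ⟨d, hχ⟩)
  obtain ⟨s, hs, hsf⟩ := hf.decomp
  have hdeg : (s.map dgc).sum = d := by
    have h1 := msum_one hs
    rw [← hsf] at h1
    simp only [Function.comp_apply, map_one, (irrCharDeg_iff.mp hχ).2] at h1
    exact_mod_cast h1.symm
  by_cases hall : ∀ γ ∈ s, dgc γ = 1
  · have := perf_deg_one hperf hs hall n
    rw [← hsf] at this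
    simpa using this
  push Not at hall
  obtain ⟨γ, hγ, hγ1⟩ := hall
  obtain ⟨s', hs'⟩ := Multiset.exists_cons_of_mem hγ
  have hγp := (hs γ hγ).dgc_pos
  rw [hs', Multiset.map_cons, Multiset.sum_cons] at hdeg
  have hd2 : d = 2 := by omega
  have hs0 : s' = 0 := by
    by_contra hne
    obtain ⟨δ, hδ⟩ := Multiset.exists_mem_of_ne_zero hne
    have h1 := (hs δ (by rw [hs']; exact Multiset.mem_cons_of_mem hδ)).dgc_pos
    have h2 : dgc δ ≤ (s'.map dgc).sum := Multiset.le_sum_of_mem (Multiset.mem_map_of_mem _ hδ)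
    omega
  have hfγ : χ ∘ N.subtype = γ := by rw [hsf, hs', hs0]; simp
  have hfi : IsIrrChar N (χ ∘ N.subtype) := by rw [hfγ]; exact hs γ hγ
  subst hd2
  obtain ⟨V, _, rfl, hV⟩ := hχ
  obtain ⟨M, hM⟩ := exists_matrix V hV
  by_cases hK : M.ker ⊓ N = ⊥
  swap
  · have h1 := hmin _ inferInstance inf_le_right hK
    have h2 : (n : G) ∈ M.ker ⊓ N := by rw [h1]; exact n.2
    rw [hM, hM, MonoidHom.mem_ker.mp h2.1, map_one]
  exfalso
  have hdet : ∀ n : N, (M n).det = 1 := fun n =>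
    perf_hom hperf ((Matrix.detMonoidHom).comp (M.comp N.subtype)) n
  rcases Nat.even_or_odd (Nat.card N) with hev | hodd
  · obtain ⟨t, ht⟩ := exists_prime_orderOf_dvd_card' (G := N) 2 hev.two_dvd
    have ht2 : t * t = 1 := by rw [← pow_two, ← ht, pow_orderOf_eq_one]
    have ht1 : t ≠ 1 := by
      intro h
      rw [h, orderOf_one] at ht
      omega
    have hcomm : ∀ y : N, t * y = y * t := by
      intro y
      have hc := mat2_central (M t) (hdet t)
        (by rw [← map_mul, ← Subgroup.coe_mul, ht2]; simp) (M y)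
      have : (((t * y) * (y * t)⁻¹ : N) : G) ∈ M.ker ⊓ N := by
        refine ⟨?_, Subtype.property _⟩
        change M _ = 1
        have e : (((t * y) * (y * t)⁻¹ : N) : G) = (t * y : G) * (y * t : G)⁻¹ := by simp
        rw [e, map_mul, map_mul, hc, ← map_mul, ← map_mul, mul_inv_cancel, map_one]
      rw [hK, Subgroup.mem_bot] at this
      have h3 : (t * y) * (y * t)⁻¹ = 1 := Subtype.ext this
      exact mul_inv_eq_one.mp h3
    have hZ := hmin (Subgroup.centralizer (N : Set G) ⊓ N) inferInstance inf_le_right (by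
      intro h
      apply ht1
      have : (t : G) ∈ Subgroup.centralizer (N : Set G) ⊓ N := by
        refine ⟨?_, t.2⟩
        refine Subgroup.mem_centralizer_iff.mpr fun y hy => ?_
        exact (congrArg Subtype.val (hcomm ⟨y, hy⟩)).symm
      rw [h, Subgroup.mem_bot] at this
      exact Subtype.ext this)
    apply hnab
    intro x y
    have hx : (x : G) ∈ Subgroup.centralizer (N : Set G) ⊓ N := by rw [hZ]; exact x.2
    apply Subtype.ext
    exact (Subgroup.mem_centralizer_iff.mp hx.1 y y.2).symm
  · have h1 : ∑ g : N, V.character (g * g : G) = ∑ g : N, V.character g := by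
      have hb : Function.Bijective (fun g : N => g ^ 2) := by
        have := (powCoprime (G := N) (n := 2) (Nat.Coprime.symm (by
          rw [Nat.coprime_two_left]; exact hodd))).bijective
        exact this
      have := hb.sum_comp (fun g : N => V.character (g : G))
      rw [← this]
      refine Finset.sum_congr rfl fun g _ => ?_
      simp [pow_two]
    have h2 := hfi.ipc_self
    obtain ⟨c, hc⟩ := ipc_nat hf (trivial_irr (H := N))
    have h3 : ipc N (V.character ∘ N.subtype) (V.character ∘ N.subtype) =
        ipc N (V.character ∘ N.subtype) 1 + 2 := by
      have hcard := cardC_ne N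
      have hsum : ∑ g : N, V.character g * V.character (g : G)⁻¹ =
          ∑ g : N, V.character g + 2 * Nat.card N := by
        rw [← h1]
        have : ∀ g : N, V.character g * V.character (g : G)⁻¹ = V.character (g * g : G) + 2 := by
          intro g
          rw [hM, hM, hM, mat2_inv (M g) (M (g : G)⁻¹) (hdet g)
            (by rw [← map_mul, inv_mul_cancel, map_one]), map_mul, mat2_sq _ (hdet g)]
          ring
        simp only [this, Finset.sum_add_distrib, Finset.sum_const, Finset.card_univ,
          ← Nat.card_eq_fintype_card, nsmul_eq_mul]
        ring
      rw [ipc_eq, ipc_eq]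
      simp only [Function.comp_apply, Subgroup.coe_subtype, Subgroup.coe_inv, Pi.one_apply, mul_one]
      rw [hsum]
      field_simp
    rw [h2, hc] at h3
    have : (1 : ℕ) = c + 2 := by exact_mod_cast h3
    omega

end kernel

section clifford

variable {G : Type} [Group G] [Finite G] (N : Subgroup G) [N.Normal] (ψ : N → ℂ)

lemma clifford_mult (hψ : IsIrrChar N ψ) (hle : N ≤ charStab N ψ)
    {θ : charStab N ψ → ℂ} {e : ℂ} (hθ : ∀ n, θ (Subgroup.inclusion hle n) = e * ψ n) :
    ipc N (indc (charStab N ψ) θ ∘ N.subtype) ψ = e := by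
  classical
  have := Fintype.ofFinite G
  have := Fintype.ofFinite N
  have h1 : indc (charStab N ψ) θ ∘ N.subtype =
      ((Nat.card (charStab N ψ) : ℂ)⁻¹ * e) •
        ∑ x : G, (ψ ∘ (MulAut.conjNormal x : MulAut N)) := by
    ext n
    simp only [Function.comp_apply, indc_eq, Pi.smul_apply, Finset.sum_apply, smul_eq_mul,
      Finset.mul_sum]
    refine Finset.sum_congr rfl fun x _ => ?_
    have hm : x * (n : G) * x⁻¹ ∈ N := Subgroup.Normal.conj_mem inferInstance _ n.2 x
    rw [mul_assoc _ e, ← hθ]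
    congr 1
    refine (dif_pos (hle hm)).trans (congrArg θ (Subtype.ext ?_))
    simp
  rw [h1, ipc_smul]
  have h2 : ∀ s : Finset G, ipc N (∑ x ∈ s, (ψ ∘ (MulAut.conjNormal x : MulAut N))) ψ =
      ∑ x ∈ s, if x ∈ charStab N ψ then (1 : ℂ) else 0 := by
    intro s
    induction s using Finset.induction with
    | empty => simp [ipc_zero]
    | insert a s ha ih =>
      rw [Finset.sum_insert ha, Finset.sum_insert ha, ipc_add, ih,
        ipc_irr (hψ.comp_equiv _) hψ]
      congr 1
      have : ψ ∘ (MulAut.conjNormal a : MulAut N) = ψ ↔ a ∈ charStab N ψ :=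
        ⟨fun h n => congrFun h n, fun h => funext h⟩
      simp only [this]
  rw [h2, Finset.sum_boole]
  have h3 : (Finset.univ.filter (fun x => x ∈ charStab N ψ)).card = Nat.card (charStab N ψ) := by
    rw [Nat.card_eq_fintype_card, Fintype.card_subtype]
  rw [h3]
  have := cardC_ne (charStab N ψ)
  field_simp

lemma clifford (hψ : IsIrrChar N ψ) (hle : N ≤ charStab N ψ)
    {θ θ' : charStab N ψ → ℂ} {e e' : ℂ} (hi : IsIrrChar _ θ) (hi' : IsIrrChar _ θ')
    (hθ : ∀ n, θ (Subgroup.inclusion hle n) = e * ψ n)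
    (hθ' : ∀ n, θ' (Subgroup.inclusion hle n) = e' * ψ n) :
    IsIrrChar G (indc _ θ) ∧ (indc _ θ = indc _ θ' → θ = θ') := by
  classical
  have hc : IsChr G (indc _ θ) := isChr_indc _ hi.isChr
  have hr := hc.comp (charStab N ψ).subtype
  obtain ⟨s, hs, hsr⟩ := hr.decomp
  have hm := clifford_mult N ψ hψ hle hθ
  have hcomp : indc (charStab N ψ) θ ∘ N.subtype = s.sum ∘ (Subgroup.inclusion hle) := by
    rw [← hsr]; rfl
  rw [hcomp, ipc_msum_comp hs _ hψ] at hm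
  -- multiplicities of irreducible characters lying over psi
  have hmul : ∀ (η : charStab N ψ → ℂ) (c : ℂ), IsIrrChar _ η →
      (∀ n, η (Subgroup.inclusion hle n) = c * ψ n) →
      (cgc (η ∘ Subgroup.inclusion hle) ψ : ℂ) = c ∧ 0 < cgc (η ∘ Subgroup.inclusion hle) ψ := by
    intro η c hη hηc
    have h1 : η ∘ Subgroup.inclusion hle = c • ψ := by ext n; simp [hηc]
    have h2 : ipc N (η ∘ Subgroup.inclusion hle) ψ = c := by
      rw [h1, ipc_smul, hψ.ipc_self, mul_one]
    have h3 := (hη.isChr.comp (Subgroup.inclusion hle)).cgc hψ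
    have h4 : (cgc (η ∘ Subgroup.inclusion hle) ψ : ℂ) = c := by rw [← h2]; exact h3.symm
    refine ⟨h4, ?_⟩
    rw [Nat.pos_iff_ne_zero]
    intro h0
    rw [h0] at h4
    have h5 := hηc 1
    rw [← h4] at h5
    simp only [map_one, hη.isChr.dgc, Nat.cast_zero, zero_mul] at h5
    have := hη.dgc_pos
    have : dgc η = 0 := by exact_mod_cast h5
    omega
  have hcnt : ipc G (indc _ θ) (indc _ θ) = s.count θ := by
    rw [frob _ _ hc, ipc_comm, hsr, ipc_count hs hi]
  have hpos : 0 < s.count θ := by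
    rw [Nat.pos_iff_ne_zero]
    intro h0
    rw [h0] at hcnt
    obtain ⟨r, hr', hrr⟩ := hc.decomp
    have hall : ∀ γ ∈ r, False := by
      intro γ hγ
      have h1 := ipc_msum r (indc _ θ)
      rw [← hrr, hcnt] at h1
      have h2 : ∀ δ ∈ r, ipc G δ (indc _ θ) = (r.count δ : ℂ) := by
        intro δ hδ
        rw [ipc_comm, hrr, ipc_count hr' (hr' δ hδ)]
      rw [Multiset.map_congr rfl h2] at h1
      have h3 : (r.map (fun δ => r.count δ)).sum = 0 := by
        have : (((r.map (fun δ => r.count δ)).sum : ℕ) : ℂ) =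
            (r.map (fun δ => (r.count δ : ℂ))).sum := by
          rw [Nat.cast_multiset_sum, Multiset.map_map]
          rfl
        exact_mod_cast this.trans h1.symm
      rw [Multiset.sum_eq_zero_iff] at h3
      have h4 := h3 _ (Multiset.mem_map_of_mem _ hγ)
      have := Multiset.count_pos.mpr hγ
      omega
    have hr0 : r = 0 := Multiset.eq_zero_of_forall_notMem hall
    have h1 := indc_one (charStab N ψ) θ
    rw [hrr, hr0, hi.isChr.dgc] at h1
    have h2 : (charStab N ψ).index * dgc θ = 0 := by
      have : ((0 : Multiset (G → ℂ)).sum) 1 = 0 := by simp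
      rw [this] at h1
      exact_mod_cast h1.symm
    rcases Nat.mul_eq_zero.mp h2 with h | h
    · exact Subgroup.FiniteIndex.index_ne_zero h
    · have := hi.dgc_pos
      omega
  obtain ⟨s', hs'⟩ := Multiset.exists_cons_of_mem (Multiset.count_pos.mp hpos)
  obtain ⟨he, hepos⟩ := hmul θ e hi hθ
  rw [hs', Multiset.map_cons, Multiset.sum_cons, ← he] at hm
  have h0 : (s'.map (fun f => cgc (f ∘ Subgroup.inclusion hle) ψ)).sum = 0 := by
    have : cgc (θ ∘ Subgroup.inclusion hle) ψ +
      (s'.map (fun f => cgc (f ∘ Subgroup.inclusion hle) ψ)).sum =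
        cgc (θ ∘ Subgroup.inclusion hle) ψ := by exact_mod_cast hm
    omega
  rw [Multiset.sum_eq_zero_iff] at h0
  have hnot : ∀ (η : charStab N ψ → ℂ) (c : ℂ), IsIrrChar _ η →
      (∀ n, η (Subgroup.inclusion hle n) = c * ψ n) → η ∉ s' := by
    intro η c hη hηc hmem
    have h1 := h0 _ (Multiset.mem_map_of_mem _ hmem)
    have h2 := (hmul η c hη hηc).2
    omega
  have hone : s.count θ = 1 := by
    rw [hs', Multiset.count_cons_self, Multiset.count_eq_zero.mpr (hnot θ e hi hθ)]
  refine ⟨IsIrrChar.of_norm hc (by rw [hcnt, hone]; simp), fun heq => ?_⟩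
  have h1 : ipc G (indc _ θ) (indc _ θ) = s.count θ' := by
    conv_lhs => rw [heq]
    rw [frob _ _ (heq ▸ hc), ipc_comm, ← heq, hsr, ipc_count hs hi']
  rw [hcnt, hone] at h1
  have h2 : s.count θ' = 1 := by exact_mod_cast h1.symm
  have h3 : θ' ∈ s := by rw [← Multiset.count_pos]; omega
  rw [hs', Multiset.mem_cons] at h3
  rcases h3 with h3 | h3
  · exact h3.symm
  · exact absurd h3 (hnot θ' e' hi' hθ')

omit [N.Normal] in
lemma fiber_bound {T : Subgroup G} {θ : T → ℂ} {d d' : ℕ} (hθ : IsIrrCharDeg T θ d)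
    (S : Finset (G → ℂ)) (hS : ∀ χ ∈ S, IsIrrCharDeg G χ d' ∧ ipc T (χ ∘ T.subtype) θ ≠ 0) :
    d' * S.card ≤ T.index * d := by
  classical
  rw [irrCharDeg_iff] at hθ
  obtain ⟨s, hs, hsr⟩ := (isChr_indc T hθ.1.isChr).decomp
  have h1 : (s.map dgc).sum = T.index * d := by
    have h1 := msum_one hs
    rw [← hsr, indc_one, hθ.2] at h1
    exact_mod_cast h1.symm
  have hle : S.val ≤ s := by
    rw [Multiset.le_iff_subset S.nodup]
    intro χ hχ
    obtain ⟨h2, h3⟩ := hS χ hχ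
    have hi : IsIrrChar G χ := ⟨_, h2⟩
    rw [← Multiset.count_pos, Nat.pos_iff_ne_zero]
    intro h4
    apply h3
    rw [ipc_comm, ← frob T θ hi.isChr, hsr, ipc_count hs hi, h4]
    simp
  have h2 : (S.val.map dgc).sum ≤ (s.map dgc).sum := by
    obtain ⟨u, hu⟩ := Multiset.le_iff_exists_add.mp hle
    rw [hu, Multiset.map_add, Multiset.sum_add]
    omega
  have h3 : (S.val.map dgc).sum = S.card * d' := by
    have : ∀ χ ∈ S.val, dgc χ = d' := fun χ hχ =>
      dgc_of_nat (irrCharDeg_iff.mp (hS χ hχ).1).2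
    rw [Multiset.map_congr rfl this]
    simp
  rw [h3, h1] at h2
  linarith

lemma count_bound (hψ : IsIrrChar N ψ) {p : ℕ} (hp : ψ 1 = p)
    (hext : ∃ χ : ↥(charStab N ψ) → ℂ, IsIrrChar ↥(charStab N ψ) χ ∧
      ExtendsToChar N (charStab N ψ) ψ χ) {d d' : ℕ} (S : Finset (G → ℂ))
    (hS : ∀ χ ∈ S, IsIrrCharDeg G χ d' ∧ (∀ n : N, χ n = χ 1) ∧
      ∃ θ, IsIrrCharDeg (charStab N ψ) θ d ∧ ipc _ (χ ∘ (charStab N ψ).subtype) θ ≠ 0) :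
    d' * S.card ≤ nChars G (d * (p * (charStab N ψ).index)) * ((charStab N ψ).index * d) := by
  classical
  obtain ⟨χ₀, hχ₀, hle, hext⟩ := hext
  have hres : χ₀ ∘ Subgroup.inclusion hle = ψ := funext hext
  choose! Θ hΘ using fun χ hχ => (hS χ hχ).2.2
  have hconst : ∀ χ ∈ S, ∀ n : N, Θ χ (Subgroup.inclusion hle n) = Θ χ 1 := by
    intro χ hχ n
    obtain ⟨h1, h2, _⟩ := hS χ hχ
    have hi : IsIrrChar G χ := ⟨_, h1⟩
    have hti : IsIrrChar _ (Θ χ) := ⟨_, (hΘ χ hχ).1⟩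
    obtain ⟨s, hs, hsr⟩ := (hi.isChr.comp (charStab N ψ).subtype).decomp
    refine const_of_mem hs (Subgroup.inclusion hle) ?_ ?_ n
    · intro k
      rw [← hsr]
      simpa using h2 k
    · have h3 := (hΘ χ hχ).2
      rw [hsr, ipc_count hs hti] at h3
      rw [← Multiset.count_pos, Nat.pos_iff_ne_zero]
      exact_mod_cast h3
  have hirrI : IsIrrChar N (χ₀ ∘ Subgroup.inclusion hle) := by rw [hres]; exact hψ
  have hgal : ∀ χ ∈ S, ∀ χ' ∈ S, ipc _ (χ₀ * Θ χ) (χ₀ * Θ χ') = ipc _ (Θ χ) (Θ χ') := by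
    intro χ hχ χ' hχ'
    exact gallagher hχ₀ (Subgroup.inclusion hle) hirrI (IsIrrChar.isChr ⟨_, (hΘ χ hχ).1⟩)
      (IsIrrChar.isChr ⟨_, (hΘ χ' hχ').1⟩) (hconst χ hχ) (hconst χ' hχ')
  have hirr : ∀ χ ∈ S, IsIrrChar _ (χ₀ * Θ χ) := by
    intro χ hχ
    have hti : IsIrrChar _ (Θ χ) := ⟨_, (hΘ χ hχ).1⟩
    apply IsIrrChar.of_norm (hχ₀.isChr.mul hti.isChr)
    rw [hgal χ hχ χ hχ, hti.ipc_self]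
  have hover : ∀ χ ∈ S, ∀ n, (χ₀ * Θ χ) (Subgroup.inclusion hle n) = Θ χ 1 * ψ n := by
    intro χ hχ n
    rw [Pi.mul_apply, hext, hconst χ hχ, mul_comm]
  let F : (G → ℂ) → (G → ℂ) := fun χ => indc (charStab N ψ) (χ₀ * Θ χ)
  have hinj : ∀ χ ∈ S, ∀ χ' ∈ S, F χ = F χ' → Θ χ = Θ χ' := by
    intro χ hχ χ' hχ' h
    have h1 := (clifford N ψ hψ hle (hirr χ hχ) (hirr χ' hχ') (hover χ hχ) (hover χ' hχ')).2 h
    have h2 := hgal χ hχ χ' hχ'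
    rw [← h1, (hirr χ hχ).ipc_self, ipc_irr ⟨_, (hΘ χ hχ).1⟩ ⟨_, (hΘ χ' hχ').1⟩] at h2
    by_contra hne
    rw [if_neg hne] at h2
    exact one_ne_zero h2
  have hχ₀1 : χ₀ 1 = p := by
    have := hext 1
    rw [map_one, hp] at this
    exact this
  have hF : ∀ χ ∈ S, IsIrrCharDeg G (F χ) (d * (p * (charStab N ψ).index)) := by
    intro χ hχ
    rw [irrCharDeg_iff]
    refine ⟨(clifford N ψ hψ hle (hirr χ hχ) (hirr χ hχ) (hover χ hχ) (hover χ hχ)).1, ?_⟩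
    change indc _ _ 1 = _
    rw [indc_one, Pi.mul_apply, hχ₀1, (irrCharDeg_iff.mp (hΘ χ hχ).1).2]
    push_cast
    ring
  have himg : (S.image F).card ≤ nChars G (d * (p * (charStab N ψ).index)) := by
    rw [nChars, Set.ncard_eq_toFinset_card _ (irrDeg_finite _)]
    apply Finset.card_le_card
    intro f hf
    obtain ⟨χ, hχ, rfl⟩ := Finset.mem_image.mp hf
    simpa using hF χ hχ
  have hfib : ∀ b ∈ S.image F, d' * (S.filter (fun χ => F χ = b)).card ≤
      (charStab N ψ).index * d := by
    intro b hb
    obtain ⟨χ, hχ, rfl⟩ := Finset.mem_image.mp hb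
    apply fiber_bound (hΘ χ hχ).1
    intro χ' hχ'
    obtain ⟨h1, h2⟩ := Finset.mem_filter.mp hχ'
    refine ⟨(hS χ' h1).1, ?_⟩
    rw [← hinj χ' h1 χ hχ h2]
    exact (hΘ χ' h1).2
  rw [Finset.card_eq_sum_card_image F S, Finset.mul_sum]
  refine (Finset.sum_le_card_nsmul _ _ _ hfib).trans ?_
  rw [smul_eq_mul]
  exact Nat.mul_le_mul_right _ himg

end clifford

lemma exists_constituent {G : Type} [Group G] [Finite G] (T : Subgroup G) {χ : G → ℂ} {d : ℕ}
    (hd : 0 < d) (hχ : IsIrrCharDeg G χ d) :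
    ∃ c θ, 0 < c ∧ c ≤ d ∧ IsIrrCharDeg T θ c ∧ ipc T (χ ∘ T.subtype) θ ≠ 0 := by
  classical
  have hi : IsIrrChar G χ := ⟨d, hχ⟩
  obtain ⟨s, hs, hsr⟩ := (hi.isChr.comp T.subtype).decomp
  have h1 : (s.map dgc).sum = d := by
    have h1 := msum_one hs
    rw [← hsr, Function.comp_apply, map_one, (irrCharDeg_iff.mp hχ).2] at h1
    exact_mod_cast h1.symm
  have hne : s ≠ 0 := by
    rintro rfl
    simp at h1
    omega
  obtain ⟨θ, hθ⟩ := Multiset.exists_mem_of_ne_zero hne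
  refine ⟨dgc θ, θ, (hs θ hθ).dgc_pos, ?_, irrCharDeg_iff.mpr ⟨hs θ hθ, (hs θ hθ).isChr.dgc⟩, ?_⟩
  · rw [← h1]
    exact Multiset.single_le_sum (fun _ _ => Nat.zero_le _) _ (Multiset.mem_map_of_mem _ hθ)
  · rw [hsr, ipc_count hs (hs θ hθ)]
    exact_mod_cast (Multiset.count_pos.mpr hθ).ne'

/-- Proposition 3.2: if `N` is a nonabelian minimal normal subgroup of `G` and `ψ ∈ Irr(N)`
extends to `T := Stab_G(ψ)`, then with `a := ψ(1)|G:T|` we have `n₁(G) ≤ n_a(G)|G:T|` and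
`n₂(G) ≤ n_{2a}(G)|G:T| + (1/2)n_a(G)|G:T|`; moreover if `G = T` then `n₂(G) ≤ n_{2a}(G)`. -/
theorem nChars_one_two_le_of_extendible
    (G : Type) [Group G] [Finite G]
    (N : Subgroup G) [N.Normal] (hbot : N ≠ ⊥)
    (hmin : ∀ M : Subgroup G, M.Normal → M ≤ N → M ≠ ⊥ → M = N)
    (hnab : ¬ ∀ x y : ↥N, x * y = y * x)
    (ψ : ↥N → ℂ) (V : FDRep ℂ ↥N) (hV : Simple V) (hψ : ψ = FDRep.character V)
    (hext : ∃ χ : ↥(charStab N ψ) → ℂ, IsIrrChar ↥(charStab N ψ) χ ∧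
      ExtendsToChar N (charStab N ψ) ψ χ) :
    nChars G 1 ≤ nChars G (finrank ℂ V * (charStab N ψ).index) * (charStab N ψ).index ∧
    (nChars G 2 : ℝ) ≤
      nChars G (2 * (finrank ℂ V * (charStab N ψ).index)) * (charStab N ψ).index +
        (1 / 2) * (nChars G (finrank ℂ V * (charStab N ψ).index) * (charStab N ψ).index) ∧
    (charStab N ψ = ⊤ →
      nChars G 2 ≤ nChars G (2 * (finrank ℂ V * (charStab N ψ).index))) := by
  classical
  have hirr : IsIrrChar N ψ := ⟨_, V, hV, hψ, rfl⟩
  have hp : ψ 1 = (finrank ℂ V : ℕ) := by rw [hψ]; exact FDRep.char_one V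
  let P : ℕ → (G → ℂ) → Prop := fun c χ => ∃ θ, IsIrrCharDeg (charStab N ψ) θ c ∧
    ipc _ (χ ∘ (charStab N ψ).subtype) θ ≠ 0
  let S : Finset (G → ℂ) := (irrDeg_finite (H := G) 2).toFinset
  have hSm : ∀ χ ∈ S, IsIrrCharDeg G χ 2 := fun χ hχ => by simpa [S] using hχ
  have hcard : nChars G 2 = S.card := by
    rw [nChars, Set.ncard_eq_toFinset_card _ (irrDeg_finite _)]
  have hsplit : (S.filter (P 2)).card + (S.filter (fun χ => ¬ P 2 χ)).card = S.card :=
    Finset.card_filter_add_card_filter_not _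
  have hB1 : ∀ χ ∈ S.filter (fun χ => ¬ P 2 χ), P 1 χ := by
    intro χ hχ
    obtain ⟨h1, h2⟩ := Finset.mem_filter.mp hχ
    obtain ⟨c, θ, hc0, hc2, hθ⟩ := exists_constituent (charStab N ψ) two_pos (hSm χ h1)
    have hc : c = 1 ∨ c = 2 := by omega
    rcases hc with rfl | rfl
    · exact ⟨θ, hθ⟩
    · exact absurd ⟨θ, hθ⟩ h2
  have hA := count_bound N ψ hirr hp hext (d := 2) (d' := 2) (S.filter (P 2)) (by
    intro χ hχ
    obtain ⟨h1, h2⟩ := Finset.mem_filter.mp hχ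
    exact ⟨hSm χ h1, const_on_N N hmin hnab (Or.inr rfl) (hSm χ h1), h2⟩)
  have hB := count_bound N ψ hirr hp hext (d := 1) (d' := 2) (S.filter (fun χ => ¬ P 2 χ)) (by
    intro χ hχ
    have h1 := (Finset.mem_filter.mp hχ).1
    exact ⟨hSm χ h1, const_on_N N hmin hnab (Or.inr rfl) (hSm χ h1), hB1 χ hχ⟩)
  have hA' : (S.filter (P 2)).card ≤
      nChars G (2 * (finrank ℂ V * (charStab N ψ).index)) * (charStab N ψ).index := by
    have : 2 * (S.filter (P 2)).card ≤
      2 * (nChars G (2 * (finrank ℂ V * (charStab N ψ).index)) * (charStab N ψ).index) := by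
      refine hA.trans (le_of_eq ?_)
      ring
    omega
  rw [one_mul, mul_one] at hB
  refine ⟨?_, ?_, ?_⟩
  · have h := count_bound N ψ hirr hp hext (d := 1) (d' := 1) (irrDeg_finite (H := G) 1).toFinset (by
      intro χ hχ
      have h1 : IsIrrCharDeg G χ 1 := by simpa using hχ
      obtain ⟨c, θ, hc0, hc2, hθ⟩ := exists_constituent (charStab N ψ) one_pos h1
      obtain rfl : c = 1 := by omega
      exact ⟨h1, const_on_N N hmin hnab (Or.inl rfl) h1, θ, hθ⟩)
    rw [one_mul, one_mul, mul_one] at h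
    rw [nChars, Set.ncard_eq_toFinset_card _ (irrDeg_finite _)]
    exact h
  · rw [hcard, ← hsplit]
    push_cast
    have hA2 : ((S.filter (P 2)).card : ℝ) ≤
      nChars G (2 * (finrank ℂ V * (charStab N ψ).index)) * (charStab N ψ).index := by
      exact_mod_cast hA'
    have hB2 : (2 : ℝ) * ((S.filter (fun χ => ¬ P 2 χ)).card : ℝ) ≤
      nChars G (finrank ℂ V * (charStab N ψ).index) * (charStab N ψ).index := by
      exact_mod_cast hB
    linarith
  · intro hT
    have hidx : (charStab N ψ).index = 1 := by rw [hT]; exact Subgroup.index_top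
    have hempty : S.filter (fun χ => ¬ P 2 χ) = ∅ := by
      rw [Finset.eq_empty_iff_forall_notMem]
      intro χ hχ
      obtain ⟨θ, hθ, hne⟩ := hB1 χ hχ
      have h := fiber_bound (d' := 2) hθ {χ} (by
        intro χ' hχ'
        rw [Finset.mem_singleton] at hχ'
        subst hχ'
        exact ⟨hSm _ (Finset.mem_filter.mp hχ).1, hne⟩)
      rw [hidx] at h
      simp at h
    rw [hempty, Finset.card_empty, add_zero] at hsplit
    rw [hcard, ← hsplit]
    rw [hidx] at hA' ⊢
    simpa using hA'
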